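/- arXiv:2112.15014 — 3 statements merged into one kernel-verified Lean document; each statement's English description precedes it below -/
import Mathlib

section
/- Let m ≥ 1 and let H be an invertible Hermitian (m+1)×(m+1) complex matrix. Let v, w ∈ ℂ^{m+1} be nonzero vectors such that the real numbers q_H(v) and q_H(w) have the same strict sign (both positive, both zero, or both negative). Then there exists a matrix A ∈ M_{m+1}(ℂ) with Aᴴ H A = H and det A = 1, and a nonzero scalar c ∈ ℂ, such that A *ᵥ v = c • w. (In other words, the special unitary group SU(H) of H acts transitively on each of the three subsets of the complex projective space ℙ(ℂ^{m+1}) determined by the strict sign of q_H.) -/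
open Matrix

/-- For a Hermitian matrix `H`, `qH H v` is the (real) value of the Hermitian form
`star v ⬝ᵥ (H *ᵥ v)`, identified with its real part. -/
noncomputable def qH {n : ℕ} (H : Matrix (Fin n) (Fin n) ℂ) (v : Fin n → ℂ) : ℝ :=
  (star v ⬝ᵥ (H *ᵥ v)).re

theorem star_dotProduct_mulVec_comm {n : Type*} [Fintype n] {H : Matrix n n ℂ}
    (hH : H.IsHermitian) (x y : n → ℂ) :
    star (star x ⬝ᵥ (H *ᵥ y)) = star y ⬝ᵥ (H *ᵥ x) := by
  rw [← star_dotProduct_star, star_star, star_mulVec, hH.eq, ← dotProduct_mulVec]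

theorem qH_coe {n : ℕ} {H : Matrix (Fin n) (Fin n) ℂ} (hH : H.IsHermitian) (v : Fin n → ℂ) :
    star v ⬝ᵥ (H *ᵥ v) = (qH H v : ℂ) :=
  (Complex.conj_eq_iff_re.1 (star_dotProduct_mulVec_comm hH v v)).symm

/-- The quasi-reflection along `u` with parameter `c` is an isometry of the form `H` as soon as
`h(u, u) = c + star c`. -/
theorem quasiReflection_isometry {n : Type*} [Fintype n] [DecidableEq n] {H : Matrix n n ℂ}
    (hH : H.IsHermitian) (u : n → ℂ) {c : ℂ} (hc : c ≠ 0)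
    (hu : star u ⬝ᵥ (H *ᵥ u) = c + star c) :
    (1 - c⁻¹ • vecMulVec u (star (H *ᵥ u)))ᴴ * H *
      (1 - c⁻¹ • vecMulVec u (star (H *ᵥ u))) = H := by
  have hc' : star c ≠ 0 := star_ne_zero.2 hc
  have hp : star u ᵥ* H = star (H *ᵥ u) := by rw [star_mulVec, hH.eq]
  simp only [conjTranspose_sub, conjTranspose_one, conjTranspose_smul, conjTranspose_vecMulVec,
    star_star, sub_mul, mul_sub, one_mul, mul_one, smul_mul_assoc, mul_smul_comm,
    vecMulVec_mul, mul_vecMulVec, hp, vecMulVec_mulVec]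
  have hd : star (H *ᵥ u) ⬝ᵥ u = c + star c := by rw [← hp, ← dotProduct_mulVec, hu]
  ext i j
  simp only [Matrix.sub_apply, Matrix.smul_apply, vecMulVec_apply, smul_eq_mul, Pi.smul_apply,
    MulOpposite.smul_eq_mul_unop, MulOpposite.unop_op, hd, star_inv₀]
  field_simp
  ring

theorem exists_isometry_mulVec_eq {n : Type*} [Fintype n] [DecidableEq n] {H : Matrix n n ℂ}
    (hH : H.IsHermitian) {v w : n → ℂ}
    (heq : star v ⬝ᵥ (H *ᵥ v) = star w ⬝ᵥ (H *ᵥ w))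
    (hne : star v ⬝ᵥ (H *ᵥ v) ≠ star w ⬝ᵥ (H *ᵥ v)) :
    ∃ A : Matrix n n ℂ, Aᴴ * H * A = H ∧ A *ᵥ v = w := by
  have hc : star (v - w) ⬝ᵥ (H *ᵥ v) ≠ 0 := by
    rwa [star_sub, sub_dotProduct, sub_ne_zero]
  refine ⟨_, quasiReflection_isometry hH (v - w) hc ?_, ?_⟩
  · rw [star_dotProduct_mulVec_comm hH]
    simp only [star_sub, sub_dotProduct, mulVec_sub, dotProduct_sub]
    rw [heq]
    ring
  · have hd : star (H *ᵥ (v - w)) ⬝ᵥ v = star (v - w) ⬝ᵥ (H *ᵥ v) := by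
      rw [star_mulVec, hH.eq, ← dotProduct_mulVec]
    rw [sub_mulVec, one_mulVec, smul_mulVec, vecMulVec_mulVec, hd, op_smul_eq_smul, smul_smul,
      inv_mul_cancel₀ hc, one_smul, sub_sub_cancel]

theorem exists_dotProduct_mulVec_ne_zero {n : Type*} [Fintype n] [DecidableEq n]
    {H : Matrix n n ℂ} (hdet : H.det ≠ 0) {v : n → ℂ} (hv : v ≠ 0) :
    ∃ x, star v ⬝ᵥ (H *ᵥ x) ≠ 0 := by
  by_contra! h
  refine hv (star_eq_zero.1 (dotProduct_eq_zero _ fun y => ?_))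
  simpa [mulVec_mulVec, mul_nonsing_inv H (isUnit_iff_ne_zero.2 hdet)] using h (H⁻¹ *ᵥ y)

theorem exists_isometry_of_isotropic {n : Type*} [Fintype n] [DecidableEq n] {H : Matrix n n ℂ}
    (hH : H.IsHermitian) (hdet : H.det ≠ 0) {v w : n → ℂ} (hv : v ≠ 0) (hw : w ≠ 0)
    (hv0 : star v ⬝ᵥ (H *ᵥ v) = 0) (hw0 : star w ⬝ᵥ (H *ᵥ w) = 0) :
    ∃ A : Matrix n n ℂ, Aᴴ * H * A = H ∧ A *ᵥ v = w := by
  by_cases hwv : star w ⬝ᵥ (H *ᵥ v) = 0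
  swap
  · exact exists_isometry_mulVec_eq hH (hv0.trans hw0.symm) (by rw [hv0]; exact Ne.symm hwv)
  obtain ⟨x, hvx, hwx⟩ : ∃ x, star v ⬝ᵥ (H *ᵥ x) ≠ 0 ∧ star w ⬝ᵥ (H *ᵥ x) ≠ 0 := by
    obtain ⟨x, hx⟩ := exists_dotProduct_mulVec_ne_zero hdet hv
    obtain ⟨y, hy⟩ := exists_dotProduct_mulVec_ne_zero hdet hw
    by_cases hwx : star w ⬝ᵥ (H *ᵥ x) = 0
    · by_cases hvy : star v ⬝ᵥ (H *ᵥ y) = 0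
      · exact ⟨x + y, by simpa [mulVec_add, hvy] using hx, by simpa [mulVec_add, hwx] using hy⟩
      · exact ⟨y, hvy, hy⟩
    · exact ⟨x, hx, hwx⟩
  have hxv := star_dotProduct_mulVec_comm hH v x
  have hxx := star_dotProduct_mulVec_comm hH x x
  set a := star v ⬝ᵥ (H *ᵥ x)
  set q := star x ⬝ᵥ (H *ᵥ x) with hq
  have ha' : star a ≠ 0 := star_ne_zero.2 hvx
  set t := -q / (2 * star a) with ht
  have hvz : star v ⬝ᵥ (H *ᵥ (x + t • v)) = a := by
    simp [mulVec_add, mulVec_smul, hv0, a]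
  have hwz : star w ⬝ᵥ (H *ᵥ (x + t • v)) = star w ⬝ᵥ (H *ᵥ x) := by
    simp [mulVec_add, mulVec_smul, hwv]
  have hz : star (x + t • v) ⬝ᵥ (H *ᵥ (x + t • v)) = 0 := by
    rw [star_add, add_dotProduct, star_smul, smul_dotProduct, hvz, mulVec_add, mulVec_smul,
      dotProduct_add, dotProduct_smul, ← hxv, ← hq, ht, star_div₀, star_neg, hxx, star_mul',
      star_star, smul_eq_mul, smul_eq_mul, star_ofNat]
    field_simp
    ring
  obtain ⟨A, hA, hAv⟩ := exists_isometry_mulVec_eq hH (hv0.trans hz.symm)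
    (by rw [hv0, ← star_dotProduct_mulVec_comm hH, hvz]; exact ha'.symm)
  obtain ⟨B, hB, hBz⟩ := exists_isometry_mulVec_eq hH (hz.trans hw0.symm)
    (by rw [hz, hwz]; exact hwx.symm)
  refine ⟨B * A, ?_, by rw [← mulVec_mulVec, hAv, hBz]⟩
  rw [conjTranspose_mul, show Aᴴ * Bᴴ * H * (B * A) = Aᴴ * (Bᴴ * H * B) * A by
    simp only [Matrix.mul_assoc], hB, hA]

theorem exists_isometry_of_anisotropic {n : ℕ} {H : Matrix (Fin n) (Fin n) ℂ}
    (hH : H.IsHermitian) {v w : Fin n → ℂ} (hvw : 0 < qH H v / qH H w) :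
    ∃ (A : Matrix (Fin n) (Fin n) ℂ) (c : ℂ), Aᴴ * H * A = H ∧ c ≠ 0 ∧ A *ᵥ v = c • w := by
  have hv0 : qH H v ≠ 0 := by rintro h; simp [h] at hvw
  have hw0 : qH H w ≠ 0 := by rintro h; simp [h] at hvw
  have key : ∀ r : ℝ, r * r = qH H v / qH H w →
      star v ⬝ᵥ (H *ᵥ v) = star ((r : ℂ) • w) ⬝ᵥ (H *ᵥ ((r : ℂ) • w)) := by
    intro r hr
    have : qH H v = r * (r * qH H w) := by rw [← mul_assoc, hr]; field_simp
    rw [star_smul, smul_dotProduct, mulVec_smul, dotProduct_smul, qH_coe hH, qH_coe hH, this]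
    simp
  obtain ⟨r, hr, hne⟩ : ∃ r : ℝ, r * r = qH H v / qH H w ∧
      star v ⬝ᵥ (H *ᵥ v) ≠ star ((r : ℂ) • w) ⬝ᵥ (H *ᵥ v) := by
    have hs := Real.mul_self_sqrt hvw.le
    by_cases h : star v ⬝ᵥ (H *ᵥ v) =
        star ((√(qH H v / qH H w) : ℂ) • w) ⬝ᵥ (H *ᵥ v)
    · refine ⟨-√(qH H v / qH H w), by rw [neg_mul_neg, hs], ?_⟩
      rw [Complex.ofReal_neg, neg_smul, star_neg, neg_dotProduct, ← h, qH_coe hH]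
      exact self_ne_neg.2 (Complex.ofReal_ne_zero.2 hv0)
    · exact ⟨_, hs, h⟩
  obtain ⟨A, hA, hAv⟩ := exists_isometry_mulVec_eq hH (key r hr) hne
  refine ⟨A, r, hA, ?_, hAv⟩
  rw [Complex.ofReal_ne_zero]
  rintro rfl
  simp [← hr] at hvw

/-- An isometry of an invertible form can be rescaled by a unit scalar to have determinant `1`. -/
theorem exists_smul_isometry_det_eq_one {n : Type*} [Fintype n] [DecidableEq n] [Nonempty n]
    {H A : Matrix n n ℂ} (hdet : H.det ≠ 0) (hA : Aᴴ * H * A = H) :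
    ∃ z : ℂ, z ≠ 0 ∧ (z • A)ᴴ * H * (z • A) = H ∧ (z • A).det = 1 := by
  have hd : star A.det * A.det = 1 := by
    have h := congrArg det hA
    rw [det_mul, det_mul, det_conjTranspose] at h
    exact mul_right_cancel₀ hdet (by linear_combination h)
  have hA0 : A.det ≠ 0 := right_ne_zero_of_mul_eq_one hd
  obtain ⟨z, hz⟩ := IsAlgClosed.exists_pow_nat_eq (A.det)⁻¹ (Fintype.card_pos (α := n))
  have hz0 : z ≠ 0 := by
    rintro rfl
    rw [zero_pow Fintype.card_ne_zero] at hz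
    exact inv_ne_zero hA0 hz.symm
  have hnA : ‖A.det‖ = 1 := by
    have h := congrArg norm hd
    rw [norm_mul, norm_star, norm_one] at h
    nlinarith [norm_nonneg A.det]
  have hnz : ‖z‖ = 1 := by
    rw [← pow_eq_one_iff_of_nonneg (norm_nonneg z) (Fintype.card_ne_zero (α := n)), ← norm_pow,
      hz, norm_inv, hnA, inv_one]
  have hzz : z * star z = 1 := by
    simpa [hnz] using Complex.mul_conj' z
  refine ⟨z, hz0, ?_, ?_⟩
  · rw [conjTranspose_smul, smul_mul_assoc, smul_mul_assoc, mul_smul_comm, hA, smul_smul,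
      mul_comm, hzz, one_smul]
  · rw [det_smul, hz, inv_mul_cancel₀ hA0]

/-- The special unitary group `SU(H)` of an invertible Hermitian form `H` on `ℂ^{m+1}` acts
transitively on each of the three subsets of `ℙ(ℂ^{m+1})` determined by the strict sign of
`q_H`. -/
theorem su_transitive_on_strata (m : ℕ) (hm : 1 ≤ m)
    (H : Matrix (Fin (m + 1)) (Fin (m + 1)) ℂ) (hH : H.IsHermitian) (hdet : H.det ≠ 0)
    (v w : Fin (m + 1) → ℂ) (hv : v ≠ 0) (hw : w ≠ 0)
    (hsign : (0 < qH H v ∧ 0 < qH H w) ∨ (qH H v = 0 ∧ qH H w = 0) ∨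
      (qH H v < 0 ∧ qH H w < 0)) :
    ∃ (A : Matrix (Fin (m + 1)) (Fin (m + 1)) ℂ) (c : ℂ),
      Aᴴ * H * A = H ∧ A.det = 1 ∧ c ≠ 0 ∧ A *ᵥ v = c • w := by
  obtain ⟨A, c, hA, hc, hAv⟩ : ∃ (A : Matrix (Fin (m + 1)) (Fin (m + 1)) ℂ) (c : ℂ),
      Aᴴ * H * A = H ∧ c ≠ 0 ∧ A *ᵥ v = c • w := by
    rcases hsign with h | h | h
    · exact exists_isometry_of_anisotropic hH (div_pos h.1 h.2)
    · obtain ⟨A, hA, hAv⟩ := exists_isometry_of_isotropic hH hdet hv hw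
        (by rw [qH_coe hH, h.1, Complex.ofReal_zero]) (by rw [qH_coe hH, h.2, Complex.ofReal_zero])
      exact ⟨A, 1, hA, one_ne_zero, by rw [hAv, one_smul]⟩
    · exact exists_isometry_of_anisotropic hH (div_pos_of_neg_of_neg h.1 h.2)
  obtain ⟨z, hz, hzA, hzdet⟩ := exists_smul_isometry_det_eq_one hdet hA
  exact ⟨z • A, z * c, hzA, hzdet, mul_ne_zero hz hc, by rw [smul_mulVec, hAv, smul_smul]⟩
end

section
/- Let H be an invertible Hermitian n×n complex matrix and let v, w ∈ ℂⁿ be nonzero vectors satisfying q_H(v) = 0 and q_H(w) = 0. Then there exists a matrix A ∈ M_n(ℂ) with Aᴴ H A = H and A *ᵥ v = w. (The unitary group U(H) acts transitively on the nonzero null vectors of q_H.) -/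
open Matrix

namespace Matrix

variable {n : Type*} [Fintype n] {H : Matrix n n ℂ}

open scoped ComplexOrder in
/-- Two nonzero vectors admit a common vector that is orthogonal to neither. -/
theorem exists_dotProduct_ne_zero_and_ne_zero {a b : n → ℂ} (ha : a ≠ 0) (hb : b ≠ 0) :
    ∃ x : n → ℂ, star x ⬝ᵥ a ≠ 0 ∧ star x ⬝ᵥ b ≠ 0 := by
  have ha' : star a ⬝ᵥ a ≠ 0 := by rwa [Ne, dotProduct_star_self_eq_zero]
  have hb' : star b ⬝ᵥ b ≠ 0 := by rwa [Ne, dotProduct_star_self_eq_zero]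
  by_cases hab : star a ⬝ᵥ b = 0
  · have hba : star b ⬝ᵥ a = 0 := by rw [star_dotProduct, hab, star_zero]
    exact ⟨a + b, by simpa [add_dotProduct, hba] using ha',
      by simpa [add_dotProduct, hab] using hb'⟩
  · exact ⟨a, ha', hab⟩

namespace IsHermitian

theorem star_dotProduct_mulVec_comm (hH : H.IsHermitian) (x y : n → ℂ) :
    star (star x ⬝ᵥ (H *ᵥ y)) = star y ⬝ᵥ (H *ᵥ x) := by
  rw [star_dotProduct, star_mulVec, hH.eq, ← dotProduct_mulVec, star_star]

/-- The rank-one perturbation `1 + c u u* H` preserves the form `H` under a scalar condition. -/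
theorem conjTranspose_mul_mul_one_add_smul_vecMulVec [DecidableEq n] (hH : H.IsHermitian)
    (u : n → ℂ) (c : ℂ) (hc : c + star c + star c * c * (star u ⬝ᵥ (H *ᵥ u)) = 0) :
    (1 + c • (vecMulVec u (star u) * H))ᴴ * H * (1 + c • (vecMulVec u (star u) * H)) = H := by
  have hP : (vecMulVec u (star u))ᴴ = vecMulVec u (star u) := by
    rw [conjTranspose_vecMulVec, star_star]
  have hPHP : vecMulVec u (star u) * H * vecMulVec u (star u) =
      (star u ⬝ᵥ (H *ᵥ u)) • vecMulVec u (star u) := by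
    rw [vecMulVec_mul, vecMulVec_mul_vecMulVec, ← dotProduct_mulVec, vecMulVec_smul]
  rw [conjTranspose_add, conjTranspose_one, conjTranspose_smul, conjTranspose_mul, hP, hH.eq]
  generalize vecMulVec u (star u) = P at *
  have hquad : H * P * H * (P * H) = (star u ⬝ᵥ (H *ᵥ u)) • (H * P * H) := by
    rw [show H * P * H * (P * H) = H * (P * H * P) * H by simp only [Matrix.mul_assoc], hPHP,
      Matrix.mul_smul, Matrix.smul_mul]
  calc (1 + star c • (H * P)) * H * (1 + c • (P * H))
      = H + (c + star c + star c * c * (star u ⬝ᵥ (H *ᵥ u))) • (H * P * H) := by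
        simp only [Matrix.add_mul, Matrix.mul_add, Matrix.one_mul, Matrix.mul_one, Matrix.smul_mul,
          Matrix.mul_smul, hquad, add_smul, smul_smul, ← Matrix.mul_assoc H P H]
        module
    _ = H := by rw [hc, zero_smul, add_zero]

/-- Two null vectors that are not orthogonal are related by a quasi-reflection. -/
theorem exists_isometry_of_dotProduct_ne_zero [DecidableEq n] (hH : H.IsHermitian)
    {v w : n → ℂ} (hv : star v ⬝ᵥ (H *ᵥ v) = 0) (hw : star w ⬝ᵥ (H *ᵥ w) = 0)
    (hwv : star w ⬝ᵥ (H *ᵥ v) ≠ 0) :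
    ∃ A : Matrix n n ℂ, Aᴴ * H * A = H ∧ A *ᵥ v = w := by
  have hvw := hH.star_dotProduct_mulVec_comm w v
  refine ⟨1 + (star w ⬝ᵥ (H *ᵥ v))⁻¹ • (vecMulVec (w - v) (star (w - v)) * H),
    hH.conjTranspose_mul_mul_one_add_smul_vecMulVec _ _ ?_, ?_⟩
  · have hb := star_ne_zero.mpr hwv
    simp only [star_sub, mulVec_sub, sub_dotProduct, dotProduct_sub, hv, hw, ← hvw, star_inv₀]
    field_simp
    ring
  · rw [add_mulVec, one_mulVec, smul_mulVec, ← mulVec_mulVec, vecMulVec_mulVec, star_sub,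
      sub_dotProduct, hv, sub_zero, op_smul_eq_smul, smul_smul, inv_mul_cancel₀ hwv, one_smul,
      add_sub_cancel]

/-- The unitary group of an invertible Hermitian form is transitive on nonzero null vectors. -/
theorem exists_isometry_of_null [DecidableEq n] (hH : H.IsHermitian) (hdet : H.det ≠ 0)
    {v w : n → ℂ} (hv0 : v ≠ 0) (hw0 : w ≠ 0)
    (hv : star v ⬝ᵥ (H *ᵥ v) = 0) (hw : star w ⬝ᵥ (H *ᵥ w) = 0) :
    ∃ A : Matrix n n ℂ, Aᴴ * H * A = H ∧ A *ᵥ v = w := by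
  by_cases hwv : star w ⬝ᵥ (H *ᵥ v) = 0
  swap
  · exact hH.exists_isometry_of_dotProduct_ne_zero hv hw hwv
  have hvw : star v ⬝ᵥ (H *ᵥ w) = 0 := by
    rw [← hH.star_dotProduct_mulVec_comm, hwv, star_zero]
  obtain ⟨x, hxv, hxw⟩ := exists_dotProduct_ne_zero_and_ne_zero
    (fun h => hv0 (eq_zero_of_mulVec_eq_zero hdet h))
    (fun h => hw0 (eq_zero_of_mulVec_eq_zero hdet h))
  obtain ⟨t, ht⟩ : ∃ t : ℂ, t = -(star x ⬝ᵥ (H *ᵥ x)) / (2 * (star x ⬝ᵥ (H *ᵥ v))) := ⟨_, rfl⟩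
  have hzv : star (x + t • v) ⬝ᵥ (H *ᵥ v) ≠ 0 := by
    simpa [add_dotProduct, hv] using hxv
  have hzw : star (x + t • v) ⬝ᵥ (H *ᵥ w) ≠ 0 := by
    simpa [add_dotProduct, hvw] using hxw
  have hz : star (x + t • v) ⬝ᵥ (H *ᵥ (x + t • v)) = 0 := by
    have hb := star_ne_zero.mpr hxv
    have hst : star t = -(star x ⬝ᵥ (H *ᵥ x)) / (2 * star (star x ⬝ᵥ (H *ᵥ v))) := by
      rw [ht, star_div₀, star_neg, hH.star_dotProduct_mulVec_comm x x, star_mul', star_ofNat]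
    simp only [star_add, star_smul, mulVec_add, mulVec_smul, add_dotProduct, dotProduct_add,
      smul_dotProduct, dotProduct_smul, smul_eq_mul, hv, ← hH.star_dotProduct_mulVec_comm x v]
    rw [hst, ht]
    field_simp
    ring
  have hwz : star w ⬝ᵥ (H *ᵥ (x + t • v)) ≠ 0 := by
    rw [← hH.star_dotProduct_mulVec_comm]
    exact star_ne_zero.mpr hzw
  obtain ⟨A, hA, hAv⟩ := hH.exists_isometry_of_dotProduct_ne_zero hv hz hzv
  obtain ⟨B, hB, hBz⟩ := hH.exists_isometry_of_dotProduct_ne_zero hz hw hwz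
  refine ⟨B * A, ?_, by rw [← mulVec_mulVec, hAv, hBz]⟩
  calc (B * A)ᴴ * H * (B * A) = Aᴴ * (Bᴴ * H * B) * A := by
        simp only [conjTranspose_mul, Matrix.mul_assoc]
    _ = H := by rw [hB, hA]

end IsHermitian

end Matrix

/-- Witt-type transitivity on the null cone: the unitary group `U(H)` of an invertible
Hermitian form `H` acts transitively on the nonzero null vectors of `q_H`. -/
theorem unitary_transitive_on_null_cone (n : ℕ)
    (H : Matrix (Fin n) (Fin n) ℂ) (hH : H.IsHermitian) (hdet : H.det ≠ 0)
    (v w : Fin n → ℂ) (hv : v ≠ 0) (hw : w ≠ 0)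
    (hqv : qH H v = 0) (hqw : qH H w = 0) :
    ∃ A : Matrix (Fin n) (Fin n) ℂ, Aᴴ * H * A = H ∧ A *ᵥ v = w := by
  have hreal (x : Fin n → ℂ) (hx : qH H x = 0) : star x ⬝ᵥ (H *ᵥ x) = 0 :=
    Complex.ext hx (Complex.conj_eq_iff_im.mp (hH.star_dotProduct_mulVec_comm x x))
  exact hH.exists_isometry_of_null hdet hv hw (hreal v hqv) (hreal w hqw)
end

section
/- Let M be an invertible (n+1)×(n+1) matrix over a field K, let A be the principal n×n submatrix of M obtained by deleting the last row and last column, and let Φ = M⁻¹. Suppose Φ_{(last,last)} = 0, and let u ∈ Kⁿ be the vector with entries u_i = Φ_{(i,last)} for i < n (the last column of Φ with its last entry removed). Then u ≠ 0, A *ᵥ u = 0, and every vector x ∈ Kⁿ with A *ᵥ x = 0 is a scalar multiple of u; i.e., the kernel of A is the one-dimensional span of u. -/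
open Matrix

/-- Appending a zero to a vector and multiplying by `M` gives, away from the last coordinate, the
product of the vector with the principal submatrix of `M`. -/
theorem Matrix.mulVec_snoc_zero_castSucc {K : Type*} [NonUnitalNonAssocSemiring K] {n : ℕ}
    (M : Matrix (Fin (n + 1)) (Fin (n + 1)) K) (x : Fin n → K) (i : Fin n) :
    (M *ᵥ (Fin.snoc x 0 : Fin (n + 1) → K)) i.castSucc =
      (M.submatrix Fin.castSucc Fin.castSucc *ᵥ x) i := by
  simp [Matrix.mulVec, dotProduct, Fin.sum_univ_castSucc]

/-- If `M` is invertible and the `(last, last)` entry of `Φ = M⁻¹` vanishes, then the last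
column of `Φ` with its last entry removed spans the (one-dimensional) kernel of the principal
submatrix `A` of `M` obtained by deleting the last row and column. -/
theorem kernel_of_principal_submatrix_spanned_by_inverse_column {K : Type*} [Field K] (n : ℕ)
    (M : Matrix (Fin (n + 1)) (Fin (n + 1)) K) (hM : IsUnit M.det)
    (hΦ : M⁻¹ (Fin.last n) (Fin.last n) = 0)
    (u : Fin n → K) (hu : ∀ i, u i = M⁻¹ (Fin.castSucc i) (Fin.last n)) :
    u ≠ 0 ∧ (M.submatrix Fin.castSucc Fin.castSucc) *ᵥ u = 0 ∧
      ∀ x : Fin n → K, (M.submatrix Fin.castSucc Fin.castSucc) *ᵥ x = 0 →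
        ∃ c : K, x = c • u := by
  have hw : (Fin.snoc u 0 : Fin (n + 1) → K) = M⁻¹ *ᵥ Pi.single (Fin.last n) 1 := by
    ext j
    refine Fin.lastCases ?_ (fun i => ?_) j
    · simp [hΦ]
    · simp [hu]
  have hMw : M *ᵥ (Fin.snoc u 0 : Fin (n + 1) → K) = Pi.single (Fin.last n) 1 := by
    rw [hw, mulVec_mulVec, mul_nonsing_inv M hM, one_mulVec]
  refine ⟨?_, ?_, fun x hx => ?_⟩
  · rintro rfl
    have h := congrFun hMw (Fin.last n)
    simp [mulVec, dotProduct, Fin.sum_univ_castSucc] at h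
  · ext i
    rw [← mulVec_snoc_zero_castSucc, hMw]
    simp
  · set y : Fin (n + 1) → K := Fin.snoc x 0 with hy
    set c := (M *ᵥ y) (Fin.last n)
    have hMy : M *ᵥ y = c • Pi.single (Fin.last n) 1 := by
      ext j
      refine Fin.lastCases ?_ (fun i => ?_) j
      · simp [c]
      · rw [hy, mulVec_snoc_zero_castSucc, hx]
        simp
    have hyc : y = c • (Fin.snoc u 0 : Fin (n + 1) → K) := by
      rw [hw, ← mulVec_smul, ← hMy, mulVec_mulVec, nonsing_inv_mul M hM, one_mulVec]
    refine ⟨c, funext fun i => ?_⟩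
    simpa [hy] using congrFun hyc i.castSucc
end
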